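/- Let Δ ⊂ ℝ² be a convex lattice polygon whose only interior lattice point is the origin (a reflexive polygon) with vertices v₁,…,v_r in counterclockwise order. For each vertex vᵢ let kᵢ = |det(m₁|m₂)| where m₁, m₂ are the primitive integral vectors pointing from vᵢ along its two adjacent edges, and let lᵢ be the lattice length (number of lattice points minus one) of the edge from vᵢ to vᵢ₊₁. Then Σᵢ kᵢ + Σᵢ lᵢ = 12. -/

import Mathlib

/-- The determinant of two vectors of `ℤ²`. -/
def det2 (u v : ℤ × ℤ) : ℤ := u.1 * v.2 - u.2 * v.1

/-- The primitive integral vector in the direction of `u ∈ ℤ²`. -/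
def primv (u : ℤ × ℤ) : ℤ × ℤ := (u.1 / Int.gcd u.1 u.2, u.2 / Int.gcd u.1 u.2)

/-- Twelve times the Dedekind sum, by the Euclidean recursion. -/
def ded (c d : ℕ) : ℚ :=
  if h : c = 0 ∨ d % c = 0 then 0
  else (c : ℚ) / (d % c : ℕ) + ((d % c : ℕ) : ℚ) / c + 1 / ((c : ℚ) * (d % c : ℕ)) - 3
    - ded (d % c) c
termination_by c
decreasing_by
  exact Nat.mod_lt _ (by omega)

lemma ded_congr (c d d' : ℕ) (h : d % c = d' % c) : ded c d = ded c d' := by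
  rw [ded, ded.eq_1 c d', h]

lemma ded_one (d : ℕ) : ded 1 d = 0 := by
  rw [ded]; simp [Nat.mod_one]

lemma ded_recip_lt (c d : ℕ) (hd : 0 < d) (h : d < c) :
    ded c d + ded d c = (c : ℚ) / d + d / c + 1 / (c * d) - 3 := by
  have hm : d % c = d := Nat.mod_eq_of_lt h
  rw [ded, dif_neg (by rw [hm]; omega), hm]
  ring

lemma ded_recip (c d : ℕ) (hc : 0 < c) (hd : 0 < d) (h : Nat.Coprime c d) :
    ded c d + ded d c = (c : ℚ) / d + d / c + 1 / (c * d) - 3 := by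
  rcases lt_trichotomy d c with h1 | h1 | h1
  · exact ded_recip_lt c d hd h1
  · subst h1
    have : d = 1 := by simpa using h
    subst this
    rw [ded_one]; norm_num
  · have := ded_recip_lt d c hc h1
    rw [add_comm, this]; ring

lemma ded_odd (a b : ℕ) (ha : 0 < a) (hb : 0 < b) (h : Nat.Coprime a b) :
    ded (a + b) a = - ded (a + b) b := by
  have h1 := ded_recip_lt (a + b) a ha (by omega)
  have h2 := ded_recip_lt (a + b) b hb (by omega)
  have h3 := ded_recip a b ha hb h
  have h4 : ded a (a + b) = ded a b := ded_congr _ _ _ (by simp)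
  have h5 : ded b (a + b) = ded b a := ded_congr _ _ _ (by simp)
  rw [h4] at h1
  rw [h5] at h2
  have ha' : (a : ℚ) ≠ 0 := by positivity
  have hb' : (b : ℚ) ≠ 0 := by positivity
  have hab' : (a : ℚ) + b ≠ 0 := by positivity
  have e : ded (a + b) a + ded (a + b) b =
      (((a + b : ℕ) : ℚ) / a + a / ((a + b : ℕ) : ℚ) + 1 / (((a + b : ℕ) : ℚ) * a) - 3)
      + (((a + b : ℕ) : ℚ) / b + b / ((a + b : ℕ) : ℚ) + 1 / (((a + b : ℕ) : ℚ) * b) - 3)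
      - ((a : ℚ) / b + b / a + 1 / (a * b) - 3) := by linarith
  have e2 : (((a + b : ℕ) : ℚ) / a + a / ((a + b : ℕ) : ℚ) + 1 / (((a + b : ℕ) : ℚ) * a) - 3)
      + (((a + b : ℕ) : ℚ) / b + b / ((a + b : ℕ) : ℚ) + 1 / (((a + b : ℕ) : ℚ) * b) - 3)
      - ((a : ℚ) / b + b / a + 1 / (a * b) - 3) = 0 := by
    push_cast
    field_simp
    ring
  linarith

/-- The signed version on integers. -/
def dd (c d : ℤ) : ℚ := (c.sign : ℚ) * ded c.natAbs (d % c).toNat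

lemma dd_add_mul (c d t : ℤ) : dd c (d + t * c) = dd c d := by
  simp [dd]

lemma dd_neg_left (c d : ℤ) : dd (-c) d = - dd c d := by
  simp [dd]

lemma dd_neg_right (c d : ℤ) (h : IsCoprime c d) : dd c (-d) = - dd c d := by
  rcases eq_or_ne c 0 with rfl | hc
  · simp [dd]
  unfold dd
  set m := c.natAbs with hm
  have hmc : ∀ z : ℤ, z % c = z % (m : ℤ) := by
    intro z; rw [hm, Int.natCast_natAbs, Int.emod_abs]
  have hmpos : 0 < m := by omega
  rw [hmc, hmc]
  have hco : IsCoprime (m : ℤ) d := by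
    rw [hm, Int.natCast_natAbs]
    rcases abs_choice c with h' | h' <;> rw [h']
    · exact h
    · exact h.neg_left
  have hnn := Int.emod_nonneg d (show (m : ℤ) ≠ 0 by omega)
  have hlt := Int.emod_lt_of_pos d (show (0 : ℤ) < m by omega)
  obtain ⟨b, hb⟩ := Int.eq_ofNat_of_zero_le hnn
  rw [hb] at hnn hlt
  have hco2 : IsCoprime (m : ℤ) (b : ℤ) := by
    have : (b : ℤ) = d + m * (-(d / m)) := by
      have := Int.emod_add_mul_ediv d m
      rw [← hb]; linarith
    rw [this]
    exact hco.add_mul_left_right _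
  have hcb : Nat.Coprime m b := Nat.isCoprime_iff_coprime.mp hco2
  rcases Nat.eq_zero_or_pos b with rfl | hbpos
  · have : m = 1 := by simpa using hcb
    rw [this, ded_one, ded_one]; simp
  · have hneg : (-d) % (m : ℤ) = ((m - b : ℕ) : ℤ) := by
      have hd : d = b + m * (d / m) := by
        have := Int.emod_add_mul_ediv d m
        rw [← hb]; linarith
      have : -d = ((m - b : ℕ) : ℤ) + m * (-(d / m) - 1) := by
        have : ((m - b : ℕ) : ℤ) = m - b := by omega
        rw [this]; linarith
      rw [this, Int.add_mul_emod_self_left]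
      apply Int.emod_eq_of_lt <;> omega
    rw [hneg, hb]
    simp only [Int.toNat_natCast]
    clear_value m
    obtain ⟨a, rfl⟩ : ∃ a, m = a + b := ⟨m - b, by omega⟩
    have : a + b - b = a := by omega
    rw [this, ded_odd a b (by omega) hbpos (by simpa using hcb)]
    ring

lemma dd_recip_pos (c d : ℤ) (hc : 0 < c) (hd : 0 < d) (h : IsCoprime c d) :
    dd c d + dd d c = (c : ℚ) / d + d / c + 1 / (c * d) - 3 * ((c * d).sign : ℤ) := by
  obtain ⟨c, rfl⟩ := Int.eq_ofNat_of_zero_le hc.le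
  obtain ⟨d, rfl⟩ := Int.eq_ofNat_of_zero_le hd.le
  have h' : Nat.Coprime c d := Nat.isCoprime_iff_coprime.mp h
  have := ded_recip c d (by omega) (by omega) h'
  unfold dd
  rw [Int.sign_eq_one_of_pos hc, Int.sign_eq_one_of_pos hd,
    Int.sign_eq_one_of_pos (mul_pos hc hd)]
  have e1 : ded c (d % c) = ded c d := ded_congr _ _ _ (by simp)
  have e2 : ded d (c % d) = ded d c := ded_congr _ _ _ (by simp)
  have f1 : ((d : ℤ) % (c : ℤ)).toNat = d % c := by
    rw [← Int.natCast_mod]; rfl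
  have f2 : ((c : ℤ) % (d : ℤ)).toNat = c % d := by
    rw [← Int.natCast_mod]; rfl
  rw [f1, f2]
  simp only [Int.natAbs_natCast]
  rw [e1, e2]
  push_cast
  linarith

lemma dd_recip (c d : ℤ) (hc : c ≠ 0) (hd : d ≠ 0) (h : IsCoprime c d) :
    dd c d + dd d c = (c : ℚ) / d + d / c + 1 / (c * d) - 3 * ((c * d).sign : ℤ) := by
  have half : ∀ c d : ℤ, 0 < c → d ≠ 0 → IsCoprime c d →
      dd c d + dd d c = (c : ℚ) / d + d / c + 1 / (c * d) - 3 * ((c * d).sign : ℤ) := by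
    intro c d hc hd h
    rcases lt_or_gt_of_ne hd with hd' | hd'
    · have := dd_recip_pos c (-d) hc (by omega) h.neg_right
      rw [dd_neg_right c d h, dd_neg_left] at this
      rw [mul_neg, Int.sign_neg] at this
      push_cast at this ⊢
      rw [div_neg, neg_div, mul_neg, div_neg] at this
      linarith
    · exact dd_recip_pos c d hc hd' h
  rcases lt_or_gt_of_ne hc with hc' | hc'
  · have := half (-c) d (by omega) hd h.neg_left
    rw [dd_neg_right d c h.symm, dd_neg_left] at this
    rw [neg_mul, Int.sign_neg] at this
    push_cast at this ⊢
    rw [div_neg, neg_div, neg_mul, div_neg] at this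
    linarith
  · exact half c d hc' hd h

/-- Rademacher function of the matrix `(x a; y b)`. -/
def rad (x y a b : ℤ) : ℚ := if y = 0 then (a : ℚ) / b else ((x : ℚ) + b) / y - dd y b

lemma rad_shift (x y a b t : ℤ) (h : x * b - y * a = 1) :
    rad x y (a + t * x) (b + t * y) = rad x y a b + t := by
  unfold rad
  rcases eq_or_ne y 0 with rfl | hy
  · simp only [zero_mul, sub_zero, mul_zero, add_zero, if_true] at h ⊢
    have hb : b ≠ 0 := by rintro rfl; simp at h
    have hx : x = b := by
      rcases Int.mul_eq_one_iff_eq_one_or_neg_one.mp h with ⟨h1, h2⟩ | ⟨h1, h2⟩ <;> omega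
    subst hx
    have : (x : ℚ) ≠ 0 := by exact_mod_cast hb
    push_cast
    field_simp
  · rw [if_neg hy, if_neg hy, dd_add_mul]
    have : (y : ℚ) ≠ 0 := by exact_mod_cast hy
    push_cast
    field_simp
    ring

lemma rad_S (x y a b : ℤ) (h : x * b - y * a = 1) :
    rad x y a b - rad a b (-x) (-y) = 3 * ((y * b).sign : ℤ) := by
  have hco : IsCoprime y b := ⟨-a, x, by linarith⟩
  unfold rad
  rcases eq_or_ne y 0 with rfl | hy
  · have hb : b ≠ 0 := by rintro rfl; simp at h
    simp only [if_true, if_neg hb]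
    have : dd b (-0) = 0 := by
      have := dd_neg_right b 0 hco.symm
      rw [neg_zero] at this ⊢
      linarith
    rw [this]; simp
  · rcases eq_or_ne b 0 with rfl | hb
    · simp only [if_true, if_neg hy]
      have : dd y 0 = 0 := by
        have := dd_neg_right y 0 hco
        rw [neg_zero] at this
        linarith
      rw [this]; push_cast; simp
    · rw [if_neg hy, if_neg hb, dd_neg_right b y hco.symm]
      have := dd_recip y b hy hb hco
      have hy' : (y : ℚ) ≠ 0 := by exact_mod_cast hy
      have hb' : (b : ℚ) ≠ 0 := by exact_mod_cast hb
      have e : ((x : ℚ) + b) / y - (a + ((-y : ℤ) : ℚ)) / b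
          = (y : ℚ) / b + b / y + 1 / (y * b) := by
        have hq : (x : ℚ) * b - y * a = 1 := by exact_mod_cast h
        push_cast
        field_simp
        linarith
      linarith

/-- One full step: along an edge of length `l`, then turn with kink `k`. -/
lemma rad_step (x y a b l k : ℤ) (h : x * b - y * a = 1) :
    rad (x + l * a) (y + l * b) (a - k * (x + l * a)) (b - k * (y + l * b)) - rad x y a b
      = - l - k + 3 * ((((y + l * b) * b).sign : ℤ) - ((y * b).sign : ℤ)) := by
  have h' : (x + l * a) * b - (y + l * b) * a = 1 := by linarith
  have h1 := rad_S x y a b h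
  have h2 := rad_S (x + l * a) (y + l * b) a b h'
  have h3 := rad_shift a b (-x) (-y) (-l) (by linarith)
  have h4 := rad_shift (x + l * a) (y + l * b) a b (-k) h'
  have e1 : -x + -l * a = -(x + l * a) := by ring
  have e2 : -y + -l * b = -(y + l * b) := by ring
  rw [e1, e2] at h3
  have e3 : a + -k * (x + l * a) = a - k * (x + l * a) := by ring
  have e4 : b + -k * (y + l * b) = b - k * (y + l * b) := by ring
  rw [e3, e4] at h4
  push_cast at *
  linarith

lemma half_space {r : ℕ} (v : Fin r → ℤ × ℤ)
    (h0 : ((0 : ℝ), (0 : ℝ)) ∈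
      interior (convexHull ℝ (Set.range fun i => (((v i).1 : ℝ), ((v i).2 : ℝ)))))
    (a b c : ℤ) (hab : 0 < a * a + b * b)
    (h : ∀ i, c ≤ a * (v i).1 + b * (v i).2) : c < 0 := by
  have hsub : convexHull ℝ (Set.range fun i => (((v i).1 : ℝ), ((v i).2 : ℝ))) ⊆
      {p : ℝ × ℝ | (c : ℝ) ≤ a * p.1 + b * p.2} := by
    apply convexHull_min
    · rintro _ ⟨i, rfl⟩
      simp only [Set.mem_ofPred_eq]
      exact_mod_cast h i
    · intro p hp q hq s t hs ht hst
      simp only [Set.mem_ofPred_eq, Prod.fst_add, Prod.snd_add, Prod.smul_fst, Prod.smul_snd,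
        smul_eq_mul] at *
      have : (c : ℝ) = s * c + t * c := by rw [← add_mul, hst, one_mul]
      nlinarith [mul_le_mul_of_nonneg_left hp hs, mul_le_mul_of_nonneg_left hq ht]
  have hn : ∀ᶠ ε : ℝ in nhds 0, ((-(ε * a) : ℝ), (-(ε * b) : ℝ)) ∈
      convexHull ℝ (Set.range fun i => (((v i).1 : ℝ), ((v i).2 : ℝ))) := by
    have hc : Continuous (fun ε : ℝ => ((-(ε * a) : ℝ), (-(ε * b) : ℝ))) := by fun_prop
    have := hc.tendsto 0
    apply this
    simpa using mem_interior_iff_mem_nhds.mp h0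
  obtain ⟨ε, hε, hpos⟩ := ((hn.filter_mono nhdsWithin_le_nhds).and
    (self_mem_nhdsWithin : Set.Ioi (0 : ℝ) ∈ nhdsWithin 0 (Set.Ioi 0))).exists
  have := hsub hε
  simp only [Set.mem_ofPred_eq] at this
  have hab' : (0 : ℝ) < a * a + b * b := by exact_mod_cast hab
  have hpos' : 0 < ε := hpos
  have : (c : ℝ) < 0 := by nlinarith [mul_pos hpos' hab']
  exact_mod_cast this

/-- Reflexivity gives height one. -/
lemma height_one {r : ℕ} (v : Fin r → ℤ × ℤ)
    (hreflexive : ∀ p : ℤ × ℤ,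
      ((p.1 : ℝ), (p.2 : ℝ)) ∈
          interior (convexHull ℝ (Set.range fun i => (((v i).1 : ℝ), ((v i).2 : ℝ)))) ↔
        p = 0) (i j : Fin r) (a b l : ℤ) (hl : 0 < l) (hco : IsCoprime a b)
    (h1 : (v j).1 = (v i).1 + l * a) (h2 : (v j).2 = (v i).2 + l * b)
    (hpos : 0 < (v i).1 * b - (v i).2 * a) : (v i).1 * b - (v i).2 * a = 1 := by
  by_contra hne
  set x := (v i).1 with hx
  set y := (v i).2 with hy
  set h := x * b - y * a with hh
  have hh2 : 2 ≤ h := by omega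
  obtain ⟨s, t, hst⟩ := hco
  -- q = (t, -s) satisfies det (q, e) = 1
  set c := x * (-s) - y * t with hc
  set n := (h - 1) * c with hn
  set m := n % h with hm
  have hm0 : 0 ≤ m := Int.emod_nonneg _ (by omega)
  have hm1 : m < h := Int.emod_lt_of_pos _ (by omega)
  have hmn : m + h * (n / h) = n := Int.emod_add_mul_ediv n h
  set f := -(n / h) with hf
  set w : ℤ × ℤ := ((h - 1) * t + f * a, (h - 1) * (-s) + f * b) with hw
  have d1 : x * w.2 - y * w.1 = m := by
    have : x * w.2 - y * w.1 = n + f * h := by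
      simp only [hw, hn, hc, hh]; ring
    rw [this, hf]; linarith
  have d2 : w.1 * b - w.2 * a = h - 1 := by
    have : w.1 * b - w.2 * a = (h - 1) * (s * a + t * b) := by
      simp only [hw]; ring
    rw [this, hst]; ring
  -- h w = (h - 1) v + m e
  have c1 : h * w.1 = (h - 1) * x + m * a := by
    rw [← d2, ← d1, hh]; ring
  have c2 : h * w.2 = (h - 1) * y + m * b := by
    rw [← d2, ← d1, hh]; ring
  have hw0 : w = 0 := by
    rw [← hreflexive]
    have h0 := (hreflexive 0).mpr rfl
    set K := convexHull ℝ (Set.range fun i => (((v i).1 : ℝ), ((v i).2 : ℝ))) with hK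
    have hconvK : Convex ℝ K := convex_convexHull _ _
    have hi : (((v i).1 : ℝ), ((v i).2 : ℝ)) ∈ K := subset_convexHull _ _ ⟨i, rfl⟩
    have hj : (((v j).1 : ℝ), ((v j).2 : ℝ)) ∈ K := subset_convexHull _ _ ⟨j, rfl⟩
    have hhR : (2 : ℝ) ≤ h := by exact_mod_cast hh2
    have hlR : (1 : ℝ) ≤ l := by exact_mod_cast hl
    have hmR0 : (0 : ℝ) ≤ m := by exact_mod_cast hm0
    have hmR1 : (m : ℝ) ≤ h - 1 := by
      have : m ≤ h - 1 := by omega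
      exact_mod_cast this
    have hh1 : (0 : ℝ) < h - 1 := by linarith
    set τ : ℝ := m / ((h - 1) * l) with hτ
    have hτ0 : 0 ≤ τ := by positivity
    have hτ1 : τ ≤ 1 := by
      rw [hτ, div_le_one (by positivity)]
      nlinarith
    have hz := hconvK hi hj (sub_nonneg.mpr hτ1) hτ0 (by ring)
    have hcomb := hconvK.combo_interior_self_mem_interior h0 hz
      (show (0 : ℝ) < 1 / h by positivity) (show (0 : ℝ) ≤ (h - 1) / h by positivity)
      (by field_simp; ring)
    convert hcomb using 1
    have c1R : (h : ℝ) * w.1 = (h - 1) * x + m * a := by exact_mod_cast c1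
    have c2R : (h : ℝ) * w.2 = (h - 1) * y + m * b := by exact_mod_cast c2
    have hlne : (l : ℝ) ≠ 0 := by positivity
    have hhne : (h : ℝ) ≠ 0 := by positivity
    have hτl : (h - 1) * (τ * l) = (m : ℝ) := by
      rw [hτ]; field_simp
    rw [h1, h2]
    ext
    · simp only [Prod.fst_add, Prod.smul_fst, smul_eq_mul, Prod.fst_zero, Int.cast_zero, mul_zero,
        zero_add]
      rw [← hx]
      push_cast
      have : (w.1 : ℝ) = ((h - 1) * x + (h - 1) * (τ * l) * a) / h := by
        rw [hτl, ← c1R]; field_simp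
      rw [this]; ring
    · simp only [Prod.snd_add, Prod.smul_snd, smul_eq_mul, Prod.snd_zero, Int.cast_zero, mul_zero,
        zero_add]
      rw [← hy]
      push_cast
      have : (w.2 : ℝ) = ((h - 1) * y + (h - 1) * (τ * l) * b) / h := by
        rw [hτl, ← c2R]; field_simp
      rw [this]; ring
  rw [hw0] at d2
  simp at d2
  omega

lemma exists_cross (r : ℕ) [NeZero r] (P : Fin r → Prop) (h1 : ∃ i, P i) (h2 : ∃ i, ¬ P i) :
    ∃ i, ¬ P i ∧ P (i + 1) := by
  by_contra hcon
  push Not at hcon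
  obtain ⟨i, hi⟩ := h2
  obtain ⟨j, hj⟩ := h1
  have : ∀ n : ℕ, ¬ P (i + Fin.ofNat r n) := by
    intro n
    induction n with
    | zero => simpa using hi
    | succ n ih =>
      have := hcon _ ih
      convert this using 2
      ext
      simp [Fin.val_add, add_assoc]
  apply this ((j - i : Fin r) : ℕ)
  convert hj using 1
  simp

lemma sign_step (a b : ℤ) : (b.sign - a.sign) * (b - a).sign =
    2 * ((if a < 0 ∧ 0 ≤ b then 1 else 0) + (if a ≤ 0 ∧ 0 < b then 1 else 0))
      - (b.sign - a.sign) := by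
  have key : ∀ z : ℤ, (0 < z ∧ z.sign = 1) ∨ (z = 0 ∧ z.sign = 0) ∨ (z < 0 ∧ z.sign = -1) := by
    intro z
    rcases lt_trichotomy z 0 with h | h | h
    · exact Or.inr (Or.inr ⟨h, Int.sign_eq_neg_one_of_neg h⟩)
    · exact Or.inr (Or.inl ⟨h, by rw [h]; rfl⟩)
    · exact Or.inl ⟨h, Int.sign_eq_one_of_pos h⟩
  rcases key a with ⟨ha, ea⟩ | ⟨ha, ea⟩ | ⟨ha, ea⟩ <;>
  rcases key b with ⟨hb, eb⟩ | ⟨hb, eb⟩ | ⟨hb, eb⟩ <;>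
  rcases key (b - a) with ⟨hc, ec⟩ | ⟨hc, ec⟩ | ⟨hc, ec⟩ <;>
  rw [ea, eb, ec] <;> split_ifs <;> omega

lemma primv_neg (u : ℤ × ℤ) : primv (-u) = - primv u := by
  unfold primv
  ext
  · simp only [Prod.fst_neg, Prod.snd_neg, Int.gcd_neg, Int.neg_gcd]
    exact Int.neg_ediv_of_dvd (Int.gcd_dvd_left ..)
  · simp only [Prod.fst_neg, Prod.snd_neg, Int.gcd_neg, Int.neg_gcd]
    exact Int.neg_ediv_of_dvd (Int.gcd_dvd_right ..)

/-- The "twelve theorem" for reflexive polygons: let `Δ ⊂ ℝ²` be a convex lattice polygon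
with vertices `v₁, …, v_r` in counterclockwise order (every other vertex lies strictly on
the left of each directed edge) whose only interior lattice point is the origin.  Let
`kᵢ = |det(m₁|m₂)|` be the kink at `vᵢ`, where `m₁, m₂` are the primitive integral vectors
pointing from `vᵢ` along its two adjacent edges, and let `lᵢ` be the lattice length of the
edge from `vᵢ` to `vᵢ₊₁`.  Then `Σᵢ kᵢ + Σᵢ lᵢ = 12`. -/
theorem stmt_0 (r : ℕ) [NeZero r] (hr : 3 ≤ r) (v : Fin r → ℤ × ℤ)
    (hconv : ∀ i j : Fin r, j ≠ i → j ≠ i + 1 →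
      0 < det2 (v (i + 1) - v i) (v j - v i))
    (hreflexive : ∀ p : ℤ × ℤ,
      ((p.1 : ℝ), (p.2 : ℝ)) ∈
          interior (convexHull ℝ (Set.range fun i => (((v i).1 : ℝ), ((v i).2 : ℝ)))) ↔
        p = 0)
    (k : Fin r → ℤ) (hk : ∀ i, k i = |det2 (primv (v (i - 1) - v i)) (primv (v (i + 1) - v i))|)
    (l : Fin r → ℤ) (hl : ∀ i, l i = Int.gcd (v (i + 1) - v i).1 (v (i + 1) - v i).2) :
    (∑ i, k i) + (∑ i, l i) = 12 := by
  have one_ne : ∀ i : Fin r, i + 1 ≠ i := by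
    intro i h
    have h1 : (1 : Fin r) = 0 := by simpa using h
    have := congrArg Fin.val h1
    rw [Fin.val_one', Fin.val_zero, Nat.mod_eq_of_lt (by omega)] at this
    omega
  have two_ne : ∀ i : Fin r, i + 1 + 1 ≠ i := by
    intro i h
    have h1 : (1 : Fin r) + 1 = 0 := by
      rw [add_assoc] at h; simpa using h
    have := congrArg Fin.val h1
    rw [Fin.val_add, Fin.val_one', Fin.val_zero, Nat.mod_eq_of_lt (by omega : 1 < r),
      Nat.mod_eq_of_lt (by omega)] at this
    omega
  have h0 : ((0 : ℝ), (0 : ℝ)) ∈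
      interior (convexHull ℝ (Set.range fun i => (((v i).1 : ℝ), ((v i).2 : ℝ)))) := by
    simpa using (hreflexive 0).mpr rfl
  set e : Fin r → ℤ × ℤ := fun i => primv (v (i + 1) - v i) with he
  -- positive lengths
  have hlpos : ∀ i, 0 < l i := by
    intro i
    rw [hl]
    rcases Nat.eq_zero_or_pos (Int.gcd (v (i + 1) - v i).1 (v (i + 1) - v i).2) with hz | hz
    · rw [Int.gcd_eq_zero_iff] at hz
      have := hconv i (i + 1 + 1) (two_ne i) (one_ne _)
      simp only [det2, hz.1, hz.2] at this
      simp at this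
    · exact_mod_cast hz
  have hd1 : ∀ i, (v (i + 1)).1 = (v i).1 + l i * (e i).1 := by
    intro i
    have : l i * (e i).1 = (v (i + 1) - v i).1 := by
      rw [hl i]; exact Int.mul_ediv_cancel' (Int.gcd_dvd_left ..)
    rw [this]; simp
  have hd2 : ∀ i, (v (i + 1)).2 = (v i).2 + l i * (e i).2 := by
    intro i
    have : l i * (e i).2 = (v (i + 1) - v i).2 := by
      rw [hl i]; exact Int.mul_ediv_cancel' (Int.gcd_dvd_right ..)
    rw [this]; simp
  have hco : ∀ i, IsCoprime (e i).1 (e i).2 := by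
    intro i
    rw [Int.isCoprime_iff_gcd_eq_one]
    have := hlpos i
    rw [hl] at this
    exact Int.gcd_ediv_gcd_ediv_gcd (by exact_mod_cast this)
  -- convexity for primitive directions
  have hcv : ∀ i j, j ≠ i → j ≠ i + 1 →
      0 < (e i).1 * ((v j).2 - (v i).2) - (e i).2 * ((v j).1 - (v i).1) := by
    intro i j h1 h2
    have := hconv i j h1 h2
    simp only [det2, Prod.fst_sub, Prod.snd_sub, hd1 i, hd2 i] at this
    have h3 : 0 < l i * ((e i).1 * ((v j).2 - (v i).2) - (e i).2 * ((v j).1 - (v i).1)) := by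
      linarith
    exact pos_of_mul_pos_right h3 (hlpos i).le
  have hcv0 : ∀ i j,
      0 ≤ (e i).1 * ((v j).2 - (v i).2) - (e i).2 * ((v j).1 - (v i).1) := by
    intro i j
    by_cases h1 : j = i
    · subst h1; simp
    by_cases h2 : j = i + 1
    · subst h2
      rw [hd1, hd2]
      apply le_of_eq; ring
    exact (hcv i j h1 h2).le
  have hdet : ∀ i, (v i).1 * (e i).2 - (v i).2 * (e i).1 = 1 := by
    intro i
    apply height_one v hreflexive i (i + 1) _ _ (l i) (hlpos i) (hco i) (hd1 i) (hd2 i)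
    have := half_space v h0 (-(e i).2) (e i).1
      (-((v i).1 * (e i).2 - (v i).2 * (e i).1)) ?_ ?_
    · linarith
    · rcases eq_or_ne (e i).2 0 with hz | hz
      · have h1 : (e i).1 ≠ 0 := by
          intro h1
          have := hco i
          rw [hz, h1] at this
          exact not_isCoprime_zero_zero this
        nlinarith [mul_self_nonneg (e i).2, mul_self_pos.mpr h1]
      · nlinarith [mul_self_nonneg (e i).1, mul_self_pos.mpr hz]
    · intro j
      have := hcv0 i j
      linarith
  -- kinks
  have hkk : ∀ i, k (i + 1) = (e i).1 * (e (i + 1)).2 - (e i).2 * (e (i + 1)).1 := by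
    intro i
    rw [hk]
    have h1 : v (i + 1 - 1) - v (i + 1) = -(v (i + 1) - v i) := by simp
    rw [h1, primv_neg]
    change |det2 (-(e i)) (e (i + 1))| = _
    have h2 := hcv i (i + 1 + 1) (two_ne i) (one_ne _)
    rw [hd1 (i + 1), hd2 (i + 1), hd1 i, hd2 i] at h2
    have h3 : 0 < l (i + 1) * ((e i).1 * (e (i + 1)).2 - (e i).2 * (e (i + 1)).1) := by
      linarith
    have h4 := pos_of_mul_pos_right h3 (hlpos _).le
    have h5 : det2 (-(e i)) (e (i + 1)) =
        -((e i).1 * (e (i + 1)).2 - (e i).2 * (e (i + 1)).1) := by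
      simp only [det2, Prod.fst_neg, Prod.snd_neg]; ring
    rw [h5, abs_neg, abs_of_pos h4]
  have hdet' : ∀ i, (v (i + 1)).1 * (e i).2 - (v (i + 1)).2 * (e i).1 = 1 := by
    intro i
    rw [hd1, hd2]; linarith [hdet i]
  have he1 : ∀ i, (e (i + 1)).1 = (e i).1 - k (i + 1) * (v (i + 1)).1 := by
    intro i
    rw [hkk]
    linear_combination (-(e (i + 1)).1) * hdet' i + (e i).1 * hdet (i + 1)
  have he2 : ∀ i, (e (i + 1)).2 = (e i).2 - k (i + 1) * (v (i + 1)).2 := by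
    intro i
    rw [hkk]
    linear_combination (-(e (i + 1)).2) * hdet' i + (e i).2 * hdet (i + 1)
  have shift : ∀ {M : Type} [AddCommMonoid M] (f : Fin r → M), ∑ i, f (i + 1) = ∑ i, f i :=
    fun f => Equiv.sum_comp (Equiv.addRight 1) f
  -- the potential
  have hstep : ∀ i, rad (v (i + 1)).1 (v (i + 1)).2 (e (i + 1)).1 (e (i + 1)).2
      - rad (v i).1 (v i).2 (e i).1 (e i).2 =
      ((- l i - k (i + 1) + 3 * (((v (i + 1)).2.sign - (v i).2.sign)
        * ((v (i + 1)).2 - (v i).2).sign) : ℤ) : ℚ) := by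
    intro i
    have := rad_step (v i).1 (v i).2 (e i).1 (e i).2 (l i) (k (i + 1)) (hdet i)
    rw [← hd1, ← hd2, ← he1, ← he2] at this
    rw [this]
    have hs : ((v (i + 1)).2 - (v i).2).sign = (e i).2.sign := by
      rw [hd2, add_sub_cancel_left, Int.sign_mul, Int.sign_eq_one_of_pos (hlpos i), one_mul]
    rw [hs, Int.sign_mul, Int.sign_mul]
    push_cast
    ring
  have hsum : ∑ i, (- l i - k (i + 1) + 3 * (((v (i + 1)).2.sign - (v i).2.sign)
        * ((v (i + 1)).2 - (v i).2).sign)) = 0 := by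
    have : ((∑ i, (- l i - k (i + 1) + 3 * (((v (i + 1)).2.sign - (v i).2.sign)
        * ((v (i + 1)).2 - (v i).2).sign)) : ℤ) : ℚ) = 0 := by
      rw [Int.cast_sum, ← Finset.sum_congr rfl (fun i _ => hstep i), Finset.sum_sub_distrib,
        shift (fun i => rad (v i).1 (v i).2 (e i).1 (e i).2), sub_self]
    exact_mod_cast this
  -- crossing inequality
  have hcross : ∀ i j, (v (j + 1)).2 * ((e i).1 * ((v j).2 - (v i).2)
        - (e i).2 * ((v j).1 - (v i).1))
      - (v j).2 * ((e i).1 * ((v (j + 1)).2 - (v i).2) - (e i).2 * ((v (j + 1)).1 - (v i).1))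
      = l j * ((e j).2 - (e i).2) := by
    intro i j
    rw [hd1 j, hd2 j]
    linear_combination (l j * (e j).2) * hdet i - (l j * (e i).2) * hdet j
  have hle : ∀ i j, (v j).2 ≤ 0 → 0 ≤ (v (j + 1)).2 → (e i).2 ≤ (e j).2 := by
    intro i j h1 h2
    have := hcross i j
    have a1 := mul_nonneg h2 (hcv0 i j)
    have a2 := mul_nonneg (neg_nonneg.mpr h1) (hcv0 i (j + 1))
    have : 0 ≤ l j * ((e j).2 - (e i).2) := by linarith
    have := nonneg_of_mul_nonneg_right this (hlpos j)
    linarith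
  have hboth : ∀ i j, (v i).2 ≤ 0 → 0 ≤ (v (i + 1)).2 → (v j).2 ≤ 0 → 0 ≤ (v (j + 1)).2 →
      (v (j + 1)).2 * ((e i).1 * ((v j).2 - (v i).2) - (e i).2 * ((v j).1 - (v i).1)) = 0 ∧
      (v j).2 * ((e i).1 * ((v (j + 1)).2 - (v i).2)
        - (e i).2 * ((v (j + 1)).1 - (v i).1)) = 0 := by
    intro i j h1 h2 h3 h4
    have heq : (e i).2 = (e j).2 := le_antisymm (hle i j h3 h4) (hle j i h1 h2)
    have := hcross i j
    rw [heq, sub_self, mul_zero] at this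
    rw [← heq] at this
    have a1 := mul_nonneg h4 (hcv0 i j)
    have a2 := mul_nonneg (neg_nonneg.mpr h3) (hcv0 i (j + 1))
    constructor <;> linarith
  have hneg : ∃ i, (v i).2 < 0 := by
    by_contra hc
    push Not at hc
    have := half_space v h0 0 1 0 (by norm_num) (by intro i; simpa using hc i)
    omega
  have hposv : ∃ i, 0 < (v i).2 := by
    by_contra hc
    push Not at hc
    have := half_space v h0 0 (-1) 0 (by norm_num) (by intro i; simpa using hc i)
    omega
  have hA : ∑ i, (if (v i).2 < 0 ∧ 0 ≤ (v (i + 1)).2 then (1 : ℤ) else 0) = 1 := by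
    obtain ⟨i, hi1, hi2⟩ := exists_cross r (fun i => 0 ≤ (v i).2)
      (hposv.imp fun i h => h.le) (hneg.imp fun i h => not_le.mpr h)
    have hi1' := not_le.mp hi1
    rw [Finset.sum_eq_single i, if_pos ⟨hi1', hi2⟩]
    · intro j _ hji
      rw [if_neg]
      rintro ⟨hj1, hj2⟩
      have := (hboth i j hi1'.le hi2 hj1.le hj2).2
      have hz := (mul_eq_zero.mp this).resolve_left hj1.ne
      by_cases h1 : j + 1 = i
      · rw [h1] at hj2; omega
      · exact absurd hz (hcv i (j + 1) h1 (fun h => hji (add_right_cancel h))).ne'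
    · simp
  have hB : ∑ i, (if (v i).2 ≤ 0 ∧ 0 < (v (i + 1)).2 then (1 : ℤ) else 0) = 1 := by
    obtain ⟨i, hi1, hi2⟩ := exists_cross r (fun i => 0 < (v i).2)
      hposv (hneg.imp fun i h => not_lt.mpr h.le)
    have hi1' := not_lt.mp hi1
    rw [Finset.sum_eq_single i, if_pos ⟨hi1', hi2⟩]
    · intro j _ hji
      rw [if_neg]
      rintro ⟨hj1, hj2⟩
      have := (hboth i j hi1' hi2.le hj1 hj2.le).1
      have hz := (mul_eq_zero.mp this).resolve_left hj2.ne'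
      by_cases h1 : j = i + 1
      · rw [h1] at hj1; omega
      · exact absurd hz (hcv i j hji h1).ne'
    · simp
  simp_rw [sign_step] at hsum
  rw [Finset.sum_add_distrib, Finset.sum_sub_distrib, Finset.sum_neg_distrib, shift k,
    ← Finset.mul_sum, Finset.sum_sub_distrib, ← Finset.mul_sum, Finset.sum_add_distrib, hA, hB,
    Finset.sum_sub_distrib, shift (fun i => (v i).2.sign)] at hsum
  linarith
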